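/- Let a > 0 be a real number and n a natural number. Then γ_{2n+1}(a) = π·Γ(2a+2n+1) / (2^{2a-2} · (2n+1)! · Γ(a)^2), where γ_m(a) = ∫_{-1}^{1} ((C_m^{(a)}(x) - C_m^{(a)}(0))/x)^2 (1-x^2)^{a - 1/2} dx and C_m^{(a)} is the Gegenbauer polynomial. -/

import Mathlib

open MeasureTheory Real

/-- The Gegenbauer polynomials `C_n^{(a)}`, defined by the recurrence
`n C_n = 2x(n+a-1) C_{n-1} - (n+2a-2) C_{n-2}` with `C_0 = 1`, `C_1 = 2ax`. -/
noncomputable def gegenbauerC (a : ℝ) : ℕ → ℝ → ℝ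
  | 0, _ => 1
  | 1, x => 2 * a * x
  | n + 2, x =>
      (2 * x * ((n : ℝ) + 1 + a) * gegenbauerC a (n + 1) x
        - ((n : ℝ) + 2 * a) * gegenbauerC a n x) / ((n : ℝ) + 2)

/-- `γ_n(a) = ∫_{-1}^1 ((C_n^{(a)}(x) - C_n^{(a)}(0))/x)^2 (1-x^2)^{a-1/2} dx`. -/
noncomputable def gegenGamma (a : ℝ) (n : ℕ) : ℝ :=
  ∫ x in (-1 : ℝ)..1,
    ((gegenbauerC a n x - gegenbauerC a n 0) / x) ^ 2 * (1 - x ^ 2) ^ (a - 1 / 2)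

open Polynomial in
/-- The Gegenbauer polynomials as elements of `ℝ[X]`. -/
noncomputable def gegenbauerPoly (a : ℝ) : ℕ → ℝ[X]
  | 0 => 1
  | 1 => C (2 * a) * X
  | n + 2 => C ((n : ℝ) + 2)⁻¹ *
      (2 * X * ((n : ℝ[X]) + 1 + C a) * gegenbauerPoly a (n + 1)
        - ((n : ℝ[X]) + 2 * C a) * gegenbauerPoly a n)

open Polynomial in
/-- The quotient of the odd Gegenbauer polynomial of degree `2 * k + 1` by `X`. -/
noncomputable def gegenbauerOddQuot (a : ℝ) : ℕ → ℝ[X]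
  | 0 => C (2 * a)
  | k + 1 => C (2 * (k : ℝ) + 3)⁻¹ *
      (2 * (2 * (k : ℝ[X]) + 2 + C a) * gegenbauerPoly a (2 * k + 2)
        - (2 * (k : ℝ[X]) + 1 + 2 * C a) * gegenbauerOddQuot a k)

section Algebra

open Polynomial

theorem eval_gegenbauerPoly (a : ℝ) (n : ℕ) (x : ℝ) :
    (gegenbauerPoly a n).eval x = gegenbauerC a n x := by
  induction n using Nat.twoStepInduction with
  | zero => simp [gegenbauerPoly, gegenbauerC]
  | one => simp [gegenbauerPoly, gegenbauerC]
  | more n ih0 ih1 =>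
    simp [gegenbauerPoly, gegenbauerC, ih0, ih1]
    ring

theorem Polynomial.C_inv_mul_cancel_left {c : ℝ} (hc : c ≠ 0) (p : ℝ[X]) :
    C c * (C c⁻¹ * p) = p := by
  rw [← mul_assoc, ← C_mul, mul_inv_cancel₀ hc, C_1, one_mul]

theorem gegenbauerPoly_recurrence (a : ℝ) (n : ℕ) :
    ((n : ℝ[X]) + 2) * gegenbauerPoly a (n + 2)
      = 2 * X * ((n : ℝ[X]) + 1 + C a) * gegenbauerPoly a (n + 1)
        - ((n : ℝ[X]) + 2 * C a) * gegenbauerPoly a n := by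
  have h : ((n : ℝ[X]) + 2) = C ((n : ℝ) + 2) := by
    simp only [map_add, map_natCast, map_ofNat]
  rw [gegenbauerPoly, h, Polynomial.C_inv_mul_cancel_left (by positivity)]

theorem gegenbauerOddQuot_recurrence (a : ℝ) (k : ℕ) :
    (2 * (k : ℝ[X]) + 3) * gegenbauerOddQuot a (k + 1)
      = 2 * (2 * (k : ℝ[X]) + 2 + C a) * gegenbauerPoly a (2 * k + 2)
        - (2 * (k : ℝ[X]) + 1 + 2 * C a) * gegenbauerOddQuot a k := by
  have h : (2 * (k : ℝ[X]) + 3) = C (2 * (k : ℝ) + 3) := by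
    simp only [map_add, map_mul, map_natCast, map_ofNat]
  rw [gegenbauerOddQuot, h, Polynomial.C_inv_mul_cancel_left (by positivity)]

theorem X_mul_gegenbauerOddQuot (a : ℝ) (k : ℕ) :
    X * gegenbauerOddQuot a k = gegenbauerPoly a (2 * k + 1) := by
  induction k with
  | zero => simp [gegenbauerOddQuot, gegenbauerPoly, mul_comm]
  | succ k ih =>
    have h : (2 * (k : ℝ[X]) + 3) ≠ 0 := by
      exact_mod_cast (by positivity : (2 * k + 3 : ℕ) ≠ 0)
    have h1 := gegenbauerPoly_recurrence a (2 * k + 1)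
    push_cast at h1
    apply mul_left_cancel₀ h
    rw [show 2 * (k + 1) + 1 = 2 * k + 1 + 2 by ring]
    linear_combination X * gegenbauerOddQuot_recurrence a k - h1
      - (2 * (k : ℝ[X]) + 1 + 2 * C a) * ih

theorem derivative_gegenbauerPoly_succ (a : ℝ) (n : ℕ) :
    derivative (gegenbauerPoly a (n + 1)) - X * derivative (gegenbauerPoly a n)
        = ((n : ℝ[X]) + 2 * C a) * gegenbauerPoly a n ∧
      X * derivative (gegenbauerPoly a (n + 1)) - derivative (gegenbauerPoly a n)
        = ((n : ℝ[X]) + 1) * gegenbauerPoly a (n + 1) := by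
  induction n with
  | zero =>
    have h : (C 2 : ℝ[X]) = 2 := map_ofNat C 2
    constructor <;> simp [gegenbauerPoly, h, mul_comm]
  | succ n ih =>
    obtain ⟨ih1, ih2⟩ := ih
    have hR := gegenbauerPoly_recurrence a n
    have hD := congrArg derivative hR
    simp only [derivative_mul, derivative_add, derivative_sub, derivative_natCast,
      derivative_C, derivative_X, derivative_one, derivative_ofNat] at hD
    have h : ((n : ℝ[X]) + 2) ≠ 0 := by
      exact_mod_cast (by positivity : (n + 2 : ℕ) ≠ 0)
    have h1 : derivative (gegenbauerPoly a (n + 1 + 1))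
        - X * derivative (gegenbauerPoly a (n + 1))
        = (((n + 1 : ℕ) : ℝ[X]) + 2 * C a) * gegenbauerPoly a (n + 1) := by
      apply mul_left_cancel₀ h
      push_cast
      linear_combination hD + ((n : ℝ[X]) + 2 * C a) * ih2
    refine ⟨h1, ?_⟩
    push_cast at h1 ⊢
    linear_combination X * h1 + X * ih2 - ih1 - hR

theorem gegenbauerPoly_differential_equation (a : ℝ) (n : ℕ) :
    (1 - X ^ 2) * derivative (derivative (gegenbauerPoly a n))
      - (2 * C a + 1) * X * derivative (gegenbauerPoly a n)
      + (n : ℝ[X]) * ((n : ℝ[X]) + 2 * C a) * gegenbauerPoly a n = 0 := by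
  cases n with
  | zero => simp [gegenbauerPoly]
  | succ n =>
    obtain ⟨h1, h2⟩ := derivative_gegenbauerPoly_succ a n
    have hD := congrArg derivative
      (show (1 - X ^ 2) * derivative (gegenbauerPoly a (n + 1))
        = -((n : ℝ[X]) + 1) * X * gegenbauerPoly a (n + 1)
          + ((n : ℝ[X]) + 2 * C a) * gegenbauerPoly a n by
        linear_combination h1 - X * h2)
    simp only [derivative_mul, derivative_add, derivative_sub, derivative_neg, derivative_natCast,
      derivative_C, derivative_X, derivative_one, derivative_ofNat, pow_two] at hD
    push_cast
    linear_combination hD - ((n : ℝ[X]) + 2 * C a) * h2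

variable {a : ℝ} {L : ℝ[X] →ₗ[ℝ] ℝ}

theorem gegenbauerPoly_orthogonal (ha : 0 < a)
    (hL : ∀ p, L ((1 - X ^ 2) * derivative p - (2 * C a + 1) * X * p) = 0)
    {m n : ℕ} (hmn : m ≠ n) : L (gegenbauerPoly a m * gegenbauerPoly a n) = 0 := by
  have h := hL (derivative (gegenbauerPoly a m) * gegenbauerPoly a n
    - gegenbauerPoly a m * derivative (gegenbauerPoly a n))
  have hc : ((n : ℝ) * (n + 2 * a) - m * (m + 2 * a)) ≠ 0 := by
    have h1 : (n : ℝ) - m ≠ 0 := sub_ne_zero.2 (by exact_mod_cast hmn.symm)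
    rw [show (n : ℝ) * (n + 2 * a) - m * (m + 2 * a) = (n - m) * (n + m + 2 * a) by ring]
    exact mul_ne_zero h1 (by positivity)
  have key : (1 - X ^ 2) * derivative (derivative (gegenbauerPoly a m) * gegenbauerPoly a n
      - gegenbauerPoly a m * derivative (gegenbauerPoly a n))
      - (2 * C a + 1) * X * (derivative (gegenbauerPoly a m) * gegenbauerPoly a n
      - gegenbauerPoly a m * derivative (gegenbauerPoly a n))
      = ((n : ℝ) * (n + 2 * a) - m * (m + 2 * a)) •
        (gegenbauerPoly a m * gegenbauerPoly a n) := by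
    rw [smul_eq_C_mul]
    simp only [derivative_mul, map_sub, map_mul, map_add, map_natCast,
      map_ofNat]
    linear_combination gegenbauerPoly a n * gegenbauerPoly_differential_equation a m
      - gegenbauerPoly a m * gegenbauerPoly_differential_equation a n
  rw [key, map_smul, smul_eq_mul] at h
  exact (mul_eq_zero.1 h).resolve_left hc

theorem gegenbauerPoly_normSq_succ (ha : 0 < a)
    (hL : ∀ p, L ((1 - X ^ 2) * derivative p - (2 * C a + 1) * X * p) = 0) (n : ℕ) :
    ((n : ℝ) + 1) * (n + 1 + a) * L (gegenbauerPoly a (n + 1) * gegenbauerPoly a (n + 1))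
      = (n + a) * (n + 2 * a) * L (gegenbauerPoly a n * gegenbauerPoly a n) := by
  have h1 : ((n : ℝ) + 2 * a) * L (gegenbauerPoly a n * gegenbauerPoly a n)
      = 2 * (n + 1 + a) * L (X * gegenbauerPoly a (n + 1) * gegenbauerPoly a n) := by
    have := congrArg L (show (n + 2 * a : ℝ) • (gegenbauerPoly a n * gegenbauerPoly a n)
      = (2 * (n + 1 + a) : ℝ) • (X * gegenbauerPoly a (n + 1) * gegenbauerPoly a n)
        - (n + 2 : ℝ) • (gegenbauerPoly a (n + 2) * gegenbauerPoly a n) by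
      simp only [smul_eq_C_mul, map_mul, map_add, map_natCast, map_ofNat, map_one]
      linear_combination gegenbauerPoly a n * gegenbauerPoly_recurrence a n)
    simpa only [map_sub, map_smul, smul_eq_mul,
      gegenbauerPoly_orthogonal ha hL (show n + 2 ≠ n by omega), mul_zero, sub_zero] using this
  have h2 : ((n : ℝ) + 1) * L (gegenbauerPoly a (n + 1) * gegenbauerPoly a (n + 1))
      = 2 * (n + a) * L (X * gegenbauerPoly a (n + 1) * gegenbauerPoly a n) := by
    cases n with
    | zero =>
      have := congrArg L (show gegenbauerPoly a 1 * gegenbauerPoly a 1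
        = (2 * a : ℝ) • (X * gegenbauerPoly a 1 * gegenbauerPoly a 0) by
        simp only [smul_eq_C_mul, gegenbauerPoly]
        ring)
      simpa using this
    | succ n =>
      have := congrArg L (show
        (n + 2 : ℝ) • (gegenbauerPoly a (n + 2) * gegenbauerPoly a (n + 2))
        = (2 * (n + 1 + a) : ℝ) • (X * gegenbauerPoly a (n + 2) * gegenbauerPoly a (n + 1))
          - (n + 2 * a : ℝ) • (gegenbauerPoly a (n + 2) * gegenbauerPoly a n) by
        simp only [smul_eq_C_mul, map_mul, map_add, map_natCast, map_ofNat, map_one]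
        linear_combination gegenbauerPoly a (n + 2) * gegenbauerPoly_recurrence a n)
      simp only [map_sub, map_smul, smul_eq_mul,
        gegenbauerPoly_orthogonal ha hL (show n + 2 ≠ n by omega), mul_zero, sub_zero] at this
      push_cast
      linear_combination this
  linear_combination ((n : ℝ) + 1 + a) * h2 - (n + a) * h1

theorem gegenbauerPoly_normSq (ha : 0 < a)
    (hL : ∀ p, L ((1 - X ^ 2) * derivative p - (2 * C a + 1) * X * p) = 0) {K : ℝ}
    (hK : a * L 1 = K * Real.Gamma (2 * a)) (n : ℕ) :
    (n + a) * n.factorial * L (gegenbauerPoly a n * gegenbauerPoly a n)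
      = K * Real.Gamma (n + 2 * a) := by
  induction n with
  | zero => simpa [gegenbauerPoly] using hK
  | succ n ih =>
    have hG : Real.Gamma (n + 1 + 2 * a) = (n + 2 * a) * Real.Gamma (n + 2 * a) := by
      rw [show (n : ℝ) + 1 + 2 * a = n + 2 * a + 1 by ring, Real.Gamma_add_one (by positivity)]
    rw [Nat.factorial_succ]
    push_cast
    rw [hG]
    linear_combination (n.factorial : ℝ) * gegenbauerPoly_normSq_succ ha hL n
      + (n + 2 * a) * ih

theorem gegenbauerPoly_mul_oddQuot (ha : 0 < a)
    (hL : ∀ p, L ((1 - X ^ 2) * derivative p - (2 * C a + 1) * X * p) = 0)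
    (k : ℕ) {j : ℕ} (hj : 2 * k < j) :
    L (gegenbauerPoly a j * gegenbauerOddQuot a k) = 0 := by
  induction k with
  | zero =>
    have h := gegenbauerPoly_orthogonal ha hL (show j ≠ 0 by omega)
    rw [gegenbauerPoly, mul_one] at h
    rw [gegenbauerOddQuot, mul_comm, ← smul_eq_C_mul, map_smul, h, smul_zero]
  | succ k ih =>
    have := congrArg L (show
      (2 * k + 3 : ℝ) • (gegenbauerPoly a j * gegenbauerOddQuot a (k + 1))
      = (2 * (2 * k + 2 + a) : ℝ) • (gegenbauerPoly a j * gegenbauerPoly a (2 * k + 2))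
        - (2 * k + 1 + 2 * a : ℝ) • (gegenbauerPoly a j * gegenbauerOddQuot a k) by
      simp only [smul_eq_C_mul, map_mul, map_add, map_natCast, map_ofNat, map_one]
      linear_combination gegenbauerPoly a j * gegenbauerOddQuot_recurrence a k)
    simp only [map_sub, map_smul, smul_eq_mul, ih (by omega),
      gegenbauerPoly_orthogonal ha hL (show j ≠ 2 * k + 2 by omega), mul_zero, sub_zero] at this
    exact (mul_eq_zero.1 this).resolve_left (by positivity)

theorem gegenbauerOddQuot_normSq (ha : 0 < a)
    (hL : ∀ p, L ((1 - X ^ 2) * derivative p - (2 * C a + 1) * X * p) = 0) {K : ℝ}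
    (hK : a * L 1 = K * Real.Gamma (2 * a)) (k : ℕ) :
    (2 * k + 1).factorial * L (gegenbauerOddQuot a k * gegenbauerOddQuot a k)
      = 2 * K * Real.Gamma (2 * a + 2 * k + 1) := by
  induction k with
  | zero =>
    have h : L (C (2 * a) * C (2 * a)) = (2 * a) * (2 * a) * L 1 := by
      rw [← C_mul, ← mul_one (C _), ← smul_eq_C_mul, map_smul, smul_eq_mul]
    simp only [gegenbauerOddQuot, h]
    simp only [Nat.cast_zero, mul_zero, add_zero, zero_add, Nat.factorial_one, Nat.cast_one]
    rw [Real.Gamma_add_one (by positivity)]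
    linear_combination 4 * a * hK
  | succ k ih =>
    have hS := congrArg L (show
      ((2 * k + 3) ^ 2 : ℝ) • (gegenbauerOddQuot a (k + 1) * gegenbauerOddQuot a (k + 1))
      = (4 * (2 * k + 2 + a) ^ 2 : ℝ) •
          (gegenbauerPoly a (2 * k + 2) * gegenbauerPoly a (2 * k + 2))
        - (4 * (2 * k + 2 + a) * (2 * k + 1 + 2 * a) : ℝ) •
          (gegenbauerPoly a (2 * k + 2) * gegenbauerOddQuot a k)
        + ((2 * k + 1 + 2 * a) ^ 2 : ℝ) • (gegenbauerOddQuot a k * gegenbauerOddQuot a k) by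
      simp only [smul_eq_C_mul, map_mul, map_add, map_pow, map_natCast, map_ofNat, map_one]
      linear_combination ((2 * (k : ℝ[X]) + 3) * gegenbauerOddQuot a (k + 1)
        + 2 * (2 * (k : ℝ[X]) + 2 + C a) * gegenbauerPoly a (2 * k + 2)
        - (2 * (k : ℝ[X]) + 1 + 2 * C a) * gegenbauerOddQuot a k)
        * gegenbauerOddQuot_recurrence a k)
    simp only [map_sub, map_add, map_smul, smul_eq_mul,
      gegenbauerPoly_mul_oddQuot ha hL k (show 2 * k < 2 * k + 2 by omega), mul_zero,
      sub_zero] at hS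
    have hN := gegenbauerPoly_normSq ha hL hK (2 * k + 2)
    have hG1 : Real.Gamma ((2 * k + 2 : ℕ) + 2 * a)
        = (2 * a + 2 * k + 1) * Real.Gamma (2 * a + 2 * k + 1) := by
      rw [← Real.Gamma_add_one (by positivity)]
      congr 1
      push_cast
      ring
    have hG2 : Real.Gamma (2 * a + 2 * (k + 1 : ℕ) + 1)
        = (2 * a + 2 * k + 2) *
          ((2 * a + 2 * k + 1) * Real.Gamma (2 * a + 2 * k + 1)) := by
      rw [← Real.Gamma_add_one (by positivity),
        show 2 * a + 2 * (k : ℝ) + 2 = 2 * a + 2 * k + 1 + 1 by ring,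
        ← Real.Gamma_add_one (by positivity)]
      congr 1
      push_cast
      ring
    have hF1 : ((2 * k + 2).factorial : ℝ) = (2 * k + 2) * (2 * k + 1).factorial := by
      rw [Nat.factorial_succ]
      push_cast
      ring
    have hF2 : ((2 * (k + 1) + 1).factorial : ℝ)
        = (2 * k + 3) * ((2 * k + 2) * (2 * k + 1).factorial) := by
      rw [show 2 * (k + 1) + 1 = 2 * k + 2 + 1 by ring, Nat.factorial_succ, ← hF1]
      push_cast
      ring
    rw [hG1, hF1] at hN
    rw [hG2, hF2]
    push_cast at hN
    have h3 : (2 * (k : ℝ) + 3) ≠ 0 := by positivity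
    apply mul_left_cancel₀ h3
    linear_combination ((2 * k + 2) * (2 * k + 1).factorial : ℝ) * hS
      + 4 * (2 * k + 2 + a) * hN + (2 * k + 1 + 2 * a) ^ 2 * (2 * k + 2) * ih

end Algebra

section Weight

theorem intervalIntegrable_one_sub_sq_rpow {s : ℝ} (hs : -1 < s) :
    IntervalIntegrable (fun x : ℝ => (1 - x ^ 2) ^ s) volume (-1) 1 := by
  have h : IntervalIntegrable (fun x : ℝ => (1 - x ^ 2) ^ s) volume 0 1 := by
    have h1 : IntervalIntegrable (fun x : ℝ => (1 - x) ^ s) volume 0 1 := by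
      simpa using! ((intervalIntegral.intervalIntegrable_rpow' hs
        (a := 0) (b := 1)).comp_sub_left 1).symm
    have h2 : ContinuousOn (fun x : ℝ => (1 + x) ^ s) (Set.uIcc 0 1) := by
      intro x hx
      rw [Set.uIcc_of_le zero_le_one] at hx
      exact (ContinuousAt.rpow_const (by fun_prop)
        (Or.inl (by linarith [hx.1]))).continuousWithinAt
    refine (h1.mul_continuousOn h2).congr fun x hx => ?_
    rw [Set.uIoc_of_le zero_le_one] at hx
    rw [← Real.mul_rpow (by linarith [hx.2]) (by linarith [hx.1])]
    ring_nf
  refine IntervalIntegrable.trans ?_ h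
  rw [IntervalIntegrable.iff_comp_neg]
  simpa using h.symm

theorem integral_one_sub_sq_rpow {s : ℝ} (hs : -1 < s) :
    ∫ x in (-1 : ℝ)..1, (1 - x ^ 2) ^ s
      = 2 * 4 ^ s * (Real.Gamma (s + 1) ^ 2 / Real.Gamma (2 * s + 2)) := by
  have hB : ∫ t in (0 : ℝ)..1, t ^ s * (1 - t) ^ s
      = Real.Gamma (s + 1) ^ 2 / Real.Gamma (2 * s + 2) := by
    have h := Complex.betaIntegral_eq_Gamma_mul_div ((s + 1 : ℝ) : ℂ) ((s + 1 : ℝ) : ℂ)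
      (by simp; linarith) (by simp; linarith)
    rw [← Complex.ofReal_add, Complex.Gamma_ofReal, Complex.Gamma_ofReal,
      Complex.betaIntegral] at h
    rw [show s + 1 + (s + 1) = 2 * s + 2 by ring] at h
    rw [← Complex.ofReal_inj, ← intervalIntegral.integral_ofReal]
    rw [pow_two]
    push_cast at h ⊢
    rw [← h]
    refine intervalIntegral.integral_congr fun t ht => ?_
    rw [Set.uIcc_of_le zero_le_one] at ht
    simp only [add_sub_cancel_right]
    rw [Complex.ofReal_cpow ht.1, Complex.ofReal_cpow (by linarith [ht.2])]
    push_cast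
    rfl
  have hC := intervalIntegral.smul_integral_comp_mul_sub (a := 0) (b := 1)
    (f := fun x : ℝ => (1 - x ^ 2) ^ s) (c := 2) (d := 1)
  norm_num at hC
  rw [← hC, ← hB, mul_assoc]
  congr 1
  rw [← intervalIntegral.integral_const_mul]
  refine intervalIntegral.integral_congr fun t ht => ?_
  rw [Set.uIcc_of_le zero_le_one] at ht
  have h1 : 0 ≤ 1 - t := by linarith [ht.2]
  rw [← Real.mul_rpow ht.1 h1, ← Real.mul_rpow (by norm_num) (mul_nonneg ht.1 h1)]
  ring_nf

end Weight

section Functional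

open Polynomial

theorem intervalIntegrable_eval_mul_weight {a : ℝ} (ha : 0 < a) (p : ℝ[X]) :
    IntervalIntegrable (fun x : ℝ => p.eval x * (1 - x ^ 2) ^ (a - 1 / 2)) volume (-1) 1 :=
  (intervalIntegrable_one_sub_sq_rpow (by linarith)).continuousOn_mul p.continuous.continuousOn

/-- Integration of polynomials against the Gegenbauer weight, as a linear functional. -/
noncomputable def gegenbauerFunctional {a : ℝ} (ha : 0 < a) : ℝ[X] →ₗ[ℝ] ℝ where
  toFun p := ∫ x in (-1 : ℝ)..1, p.eval x * (1 - x ^ 2) ^ (a - 1 / 2)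
  map_add' p q := by
    rw [← intervalIntegral.integral_add (intervalIntegrable_eval_mul_weight ha p)
      (intervalIntegrable_eval_mul_weight ha q)]
    simp [add_mul]
  map_smul' c p := by
    simp [← intervalIntegral.integral_const_mul, mul_assoc]

theorem gegenbauerFunctional_apply {a : ℝ} (ha : 0 < a) (p : ℝ[X]) :
    gegenbauerFunctional ha p
      = ∫ x in (-1 : ℝ)..1, p.eval x * (1 - x ^ 2) ^ (a - 1 / 2) := rfl

theorem gegenbauerFunctional_integration_by_parts {a : ℝ} (ha : 0 < a) (p : ℝ[X]) :
    gegenbauerFunctional ha ((1 - X ^ 2) * derivative p - (2 * C a + 1) * X * p) = 0 := by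
  rw [gegenbauerFunctional_apply, intervalIntegral.integral_eq_sub_of_hasDerivAt_of_le
    (f := fun x : ℝ => p.eval x * (1 - x ^ 2) ^ (a + 1 / 2)) (by norm_num) ?_ ?_
    (intervalIntegrable_eval_mul_weight ha _)]
  · simp [show a + 2⁻¹ ≠ 0 by positivity]
  · exact (p.continuous.mul (Continuous.rpow_const (by fun_prop)
      fun x => Or.inr (by positivity))).continuousOn
  · intro x hx
    have hpos : 0 < 1 - x ^ 2 := by nlinarith [hx.1, hx.2]
    have h1 : HasDerivAt (fun x : ℝ => 1 - x ^ 2) (-(2 * x)) x := by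
      simpa using ((hasDerivAt_pow 2 x).const_sub 1)
    have h2 := (p.hasDerivAt x).mul (h1.rpow_const (p := a + 1 / 2) (Or.inl hpos.ne'))
    convert! h2 using 1
    rw [show a + 1 / 2 - 1 = a - 1 / 2 by ring,
      show a + 1 / 2 = a - 1 / 2 + 1 by ring, Real.rpow_add_one hpos.ne']
    simp
    ring

theorem mul_gegenbauerFunctional_one {a : ℝ} (ha : 0 < a) :
    a * gegenbauerFunctional ha 1
      = π / (2 ^ (2 * a - 1) * Real.Gamma a ^ 2) * Real.Gamma (2 * a) := by
  have h := integral_one_sub_sq_rpow (s := a - 1 / 2) (by linarith)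
  rw [gegenbauerFunctional_apply]
  simp only [eval_one, one_mul]
  rw [h, show a - 1 / 2 + 1 = a + 1 / 2 by ring, show 2 * (a - 1 / 2) + 2 = 2 * a + 1 by ring,
    Real.Gamma_add_one (by positivity)]
  have hG : 0 < Real.Gamma a := Real.Gamma_pos_of_pos ha
  have hG2 : 0 < Real.Gamma (2 * a) := Real.Gamma_pos_of_pos (by positivity)
  have hdup : Real.Gamma a ^ 2 * Real.Gamma (a + 1 / 2) ^ 2
      = Real.Gamma (2 * a) ^ 2 * (2 ^ (1 - 2 * a)) ^ 2 * π := by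
    rw [← mul_pow, Real.Gamma_mul_Gamma_add_half, mul_pow, mul_pow, Real.sq_sqrt Real.pi_pos.le]
  have h4 : (4 : ℝ) ^ (a - 1 / 2) = 2 ^ (2 * a - 1) := by
    rw [show (4 : ℝ) = 2 ^ (2 : ℝ) by norm_num, ← Real.rpow_mul (by norm_num)]
    ring_nf
  have h2 : (2 : ℝ) ^ (1 - 2 * a) * 2 ^ (2 * a - 1) = 1 := by
    rw [← Real.rpow_add (by norm_num)]
    simp
  rw [h4]
  generalize (2 : ℝ) ^ (1 - 2 * a) = u at *
  have hv : (0 : ℝ) < 2 ^ (2 * a - 1) := by positivity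
  generalize (2 : ℝ) ^ (2 * a - 1) = v at *
  generalize Real.Gamma (a + 1 / 2) = g at *
  generalize Real.Gamma (2 * a) = w at *
  field_simp
  linear_combination v ^ 2 * hdup + w ^ 2 * π * (u * v + 1) * h2

theorem gegenGamma_odd_eq_gegenbauerFunctional {a : ℝ} (ha : 0 < a) (n : ℕ) :
    gegenGamma a (2 * n + 1)
      = gegenbauerFunctional ha (gegenbauerOddQuot a n * gegenbauerOddQuot a n) := by
  rw [gegenGamma, gegenbauerFunctional_apply]
  refine intervalIntegral.integral_congr_ae ?_
  have h0 : ∀ᵐ x : ℝ, x ≠ 0 := by simp [ae_iff]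
  filter_upwards [h0] with x hx _
  simp only [← eval_gegenbauerPoly, ← X_mul_gegenbauerOddQuot, eval_mul, eval_X, zero_mul,
    sub_zero, mul_div_cancel_left₀ _ hx, pow_two]

end Functional

theorem gegenbauer_gamma_odd (a : ℝ) (ha : 0 < a) (n : ℕ) :
    gegenGamma a (2 * n + 1)
      = π * Real.Gamma (2 * a + 2 * n + 1)
          / ((2 : ℝ) ^ (2 * a - 2) * ((2 * n + 1).factorial : ℝ) * Real.Gamma a ^ 2) := by
  have h := gegenbauerOddQuot_normSq ha (gegenbauerFunctional_integration_by_parts ha)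
    (mul_gegenbauerFunctional_one ha) n
  have hG : 0 < Real.Gamma a := Real.Gamma_pos_of_pos ha
  have h2 : (2 : ℝ) ^ (2 * a - 1) = 2 ^ (2 * a - 2) * 2 := by
    rw [← Real.rpow_add_one (by norm_num)]
    ring_nf
  rw [← gegenGamma_odd_eq_gegenbauerFunctional ha, h2] at h
  have hv : (0 : ℝ) < 2 ^ (2 * a - 2) := by positivity
  generalize (2 : ℝ) ^ (2 * a - 2) = v at *
  generalize Real.Gamma (2 * a + 2 * n + 1) = w at *
  rw [eq_div_iff (by positivity)]
  field_simp at h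
  linear_combination h
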